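/- arXiv:1307.8442 — 3 statements merged into one kernel-verified Lean document; each statement's English description precedes it below -/
import Mathlib

section
/- Let 𝒢 = (φ_j : G → G_j : 1 ≤ j ≤ m) be an Abelian group HBL datum, let s ∈ [0,1]^m, and let H ≤ G be any finite subgroup. Then 𝔹(𝒢,s) ≥ A(H,s) = |H| · ∏_{j=1}^m |φ_j(H)|^{-s_j}. -/
open scoped ENNReal

/-- The `L^{1/s}` norm with respect to counting measure; for `s = 0` this is the sup norm
`‖f‖_∞`, and for `s ≠ 0` it is `(∑_y f(y)^{1/s})^s`. -/
noncomputable def HBLnorm {α : Type*} (s : ℝ) (f : α → ℝ≥0∞) : ℝ≥0∞ :=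
  if s = 0 then ⨆ y, f y else (∑' y, f y ^ (1 / s)) ^ s

/-- The optimal constant `𝔹(𝒢,s)`: the smallest `C ∈ [0,∞]` such that
`∑_{x ∈ G} ∏_j f_j(φ_j x) ≤ C ∏_j ‖f_j‖_{1/s_j}` for all nonnegative `f_j`. -/
noncomputable def HBLB {G : Type*} [AddCommGroup G] {m : ℕ} {Gj : Fin m → Type*}
    [∀ j, AddCommGroup (Gj j)] (φ : ∀ j, G →+ Gj j) (s : Fin m → ℝ) : ℝ≥0∞ :=
  sInf {C : ℝ≥0∞ | ∀ f : ∀ j, Gj j → ℝ≥0∞,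
    ∑' x : G, ∏ j, f j (φ j x) ≤ C * ∏ j, HBLnorm (s j) (f j)}

/-- The quantity `A(H,s) = |H| · ∏_j |φ_j(H)|^{-s_j}` associated to a subgroup `H ≤ G`. -/
noncomputable def HBLAloc {G : Type*} [AddCommGroup G] {m : ℕ} {Gj : Fin m → Type*}
    [∀ j, AddCommGroup (Gj j)] (φ : ∀ j, G →+ Gj j) (s : Fin m → ℝ) (H : AddSubgroup G) :
    ℝ≥0∞ :=
  (Nat.card H : ℝ≥0∞) * ∏ j, (Nat.card (H.map (φ j)) : ℝ≥0∞) ^ (-(s j))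

/-- `𝔸(𝒢,s) = sup { A(H,s) : H a finite subgroup of G }`. -/
noncomputable def HBLA {G : Type*} [AddCommGroup G] {m : ℕ} {Gj : Fin m → Type*}
    [∀ j, AddCommGroup (Gj j)] (φ : ∀ j, G →+ Gj j) (s : Fin m → ℝ) : ℝ≥0∞ :=
  ⨆ (H : AddSubgroup G) (_ : (H : Set G).Finite), HBLAloc φ s H

theorem tsum_indicator_one_eq_natCard {α : Type*} {S : Set α} (hS : S.Finite) :
    ∑' x, S.indicator (1 : α → ℝ≥0∞) x = Nat.card S := by
  rw [← tsum_subtype]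
  simp [← hS.cast_ncard_eq]

/-- The `L^{1/s}` norm of the indicator function of a finite nonempty set `S` is `|S|^s`. -/
theorem HBLnorm_indicator_one {α : Type*} {s : ℝ} {S : Set α} (hS : S.Finite)
    (hne : S.Nonempty) (hs : 0 ≤ s) :
    HBLnorm s (S.indicator 1) = (Nat.card S : ℝ≥0∞) ^ s := by
  unfold HBLnorm
  split_ifs with h
  · subst h
    obtain ⟨y, hy⟩ := hne
    rw [ENNReal.rpow_zero]
    refine le_antisymm (iSup_le fun z => Set.indicator_le_self' (by simp) z) ?_
    exact le_iSup_of_le y (by simp [hy])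
  · have hpos : 0 < s := lt_of_le_of_ne hs (Ne.symm h)
    have hpow : (fun y => S.indicator (1 : α → ℝ≥0∞) y ^ (1 / s)) = S.indicator 1 := by
      funext y
      by_cases hy : y ∈ S <;> simp [hy, hpos]
    rw [hpow, tsum_indicator_one_eq_natCard hS]

/-- **Lemma.** For any Abelian group HBL datum `𝒢`, any `s ∈ [0,1]^m` and any finite
subgroup `H ≤ G`, one has `𝔹(𝒢,s) ≥ A(H,s) = |H| · ∏_j |φ_j(H)|^{-s_j}`. -/
theorem HBLB_ge_Aloc {G : Type*} [AddCommGroup G]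
    {m : ℕ} (hm : 0 < m) {Gj : Fin m → Type*} [∀ j, AddCommGroup (Gj j)]
    (φ : ∀ j, G →+ Gj j) (s : Fin m → ℝ) (hs : ∀ j, s j ∈ Set.Icc (0 : ℝ) 1)
    (H : AddSubgroup G) (hH : (H : Set G).Finite) :
    (Nat.card H : ℝ≥0∞) * ∏ j, (Nat.card (H.map (φ j)) : ℝ≥0∞) ^ (-(s j)) ≤ HBLB φ s := by
  refine le_sInf fun C hC => ?_
  have hmap : ∀ j, (H.map (φ j) : Set (Gj j)).Finite := fun j => by
    rw [AddSubgroup.coe_map]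
    exact hH.image _
  have hfin : ∀ j, Finite (H.map (φ j)) := fun j => (hmap j).to_subtype
  have hcard : (Nat.card H : ℝ≥0∞) ≤
      ∑' x : G, ∏ j, (H.map (φ j) : Set (Gj j)).indicator (1 : Gj j → ℝ≥0∞) (φ j x) := by
    calc (Nat.card H : ℝ≥0∞) = ∑' x : G, (H : Set G).indicator (1 : G → ℝ≥0∞) x :=
          (tsum_indicator_one_eq_natCard hH).symm
      _ ≤ _ := by
          refine ENNReal.tsum_le_tsum fun x => ?_
          by_cases hx : x ∈ (H : Set G)
          · rw [Set.indicator_of_mem hx]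
            refine (Finset.prod_eq_one fun j _ => ?_).ge
            exact Set.indicator_of_mem (AddSubgroup.mem_map_of_mem (φ j) hx) _
          · rw [Set.indicator_of_notMem hx]
            exact zero_le
  have key := hcard.trans (hC fun j => (H.map (φ j) : Set (Gj j)).indicator 1)
  simp_rw [fun j => HBLnorm_indicator_one (hmap j) ⟨0, zero_mem _⟩ (hs j).1] at key
  refine (mul_le_mul_left key _).trans_eq ?_
  rw [mul_assoc, ← Finset.prod_mul_distrib, Finset.prod_eq_one, mul_one]
  intro j _
  change (Nat.card (H.map (φ j)) : ℝ≥0∞) ^ s j * _ = 1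
  rw [← ENNReal.rpow_add _ _ (Nat.cast_ne_zero.2 Nat.card_pos.ne') (ENNReal.natCast_ne_top _),
    add_neg_cancel, ENNReal.rpow_zero]
end

section
/- Let 𝒢 = (φ_j : G → G_j : 1 ≤ j ≤ m) be an Abelian group HBL datum (no finiteness or finite generation assumed) and let s ∈ [0,1]^m. Let G' ≤ G be any subgroup, let 𝒢' = (φ_j|_{G'} : G' → φ_j(G')) be the associated sub-datum, and let 𝒢/𝒢' = (ψ_j : G/G' → G_j/φ_j(G')) be the associated quotient datum. Then 𝔹(𝒢,s) ≤ 𝔹(𝒢/𝒢',s) · 𝔹(𝒢',s). -/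
open scoped ENNReal

theorem QuotientAddGroup.bijective_out_add {A : Type*} [AddCommGroup A] (H : AddSubgroup A) :
    Function.Bijective fun p : (A ⧸ H) × H => p.1.out + (p.2 : A) := by
  constructor
  · rintro ⟨q, h⟩ ⟨q', h'⟩ e
    have hq : q = q' := by
      have := congrArg (QuotientAddGroup.mk : A → A ⧸ H) e
      simpa [QuotientAddGroup.mk_add_of_mem] using this
    subst hq
    simpa using e
  · intro a
    obtain ⟨h, hh⟩ := QuotientAddGroup.mk_out_eq_add H a
    exact ⟨(a, -h), by simp [hh]⟩

/-- The bijection `A ⧸ H × H ≃ A` given by choosing coset representatives. -/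
noncomputable def QuotientAddGroup.outAddEquiv {A : Type*} [AddCommGroup A] (H : AddSubgroup A) :
    (A ⧸ H) × H ≃ A :=
  Equiv.ofBijective _ (QuotientAddGroup.bijective_out_add H)

theorem QuotientAddGroup.outAddEquiv_apply {A : Type*} [AddCommGroup A] (H : AddSubgroup A)
    (q : A ⧸ H) (h : H) : QuotientAddGroup.outAddEquiv H (q, h) = q.out + (h : A) := rfl

theorem HBLnorm_comp_equiv {α β : Type*} (e : α ≃ β) (s : ℝ) (f : β → ℝ≥0∞) :
    HBLnorm s (fun a => f (e a)) = HBLnorm s f := by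
  unfold HBLnorm
  rw [e.iSup_comp (g := f), e.tsum_eq fun y => f y ^ (1 / s)]

theorem HBLnorm_prod {α β : Type*} (s : ℝ) (f : α × β → ℝ≥0∞) :
    HBLnorm s (fun a => HBLnorm s fun b => f (a, b)) = HBLnorm s f := by
  unfold HBLnorm
  split_ifs with h
  · exact (iSup_prod (f := f)).symm
  · simp_rw [← ENNReal.rpow_mul, mul_one_div_cancel h, ENNReal.rpow_one]
    rw [ENNReal.tsum_prod (f := fun a b => f (a, b) ^ (1 / s))]

theorem eq_zero_of_HBLnorm_eq_zero {α : Type*} {s : ℝ} (hs : 0 ≤ s) {f : α → ℝ≥0∞}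
    (h : HBLnorm s f = 0) (y : α) : f y = 0 := by
  unfold HBLnorm at h
  split_ifs at h with h0
  · exact ENNReal.iSup_eq_zero.mp h y
  · have hpos : 0 < s := lt_of_le_of_ne hs (Ne.symm h0)
    have := ENNReal.tsum_eq_zero.mp ((ENNReal.rpow_eq_zero_iff_of_pos hpos).mp h) y
    exact (ENNReal.rpow_eq_zero_iff_of_pos (one_div_pos.mpr hpos)).mp this

theorem HBLnorm_single_one {α : Type*} [DecidableEq α] (s : ℝ) (hs : 0 ≤ s) (a : α) :
    HBLnorm s (Pi.single a 1 : α → ℝ≥0∞) = 1 := by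
  unfold HBLnorm
  split_ifs with h0
  · apply le_antisymm
    · refine iSup_le fun y => ?_
      by_cases hy : y = a
      · subst hy; simp
      · simp [hy]
    · exact le_iSup_of_le a (by simp)
  · have hpos : 0 < s := lt_of_le_of_ne hs (Ne.symm h0)
    rw [tsum_eq_single a]
    · simp
    · intro y hy
      simp [hy, hpos]

theorem HBLnorm_translate_eq {A : Type*} [AddCommGroup A] {H : AddSubgroup A} (s : ℝ)
    (f : A → ℝ≥0∞) {a b : A} (h : (a : A ⧸ H) = b) :
    HBLnorm s (fun y : H => f (a + y)) = HBLnorm s (fun y : H => f (b + y)) := by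
  have hm : -a + b ∈ H := QuotientAddGroup.eq.mp h
  rw [← HBLnorm_comp_equiv (Equiv.addLeft (⟨-a + b, hm⟩ : H)) s fun y : H => f (a + y)]
  congr! 3 with y
  simp [add_assoc]

theorem HBLnorm_coset {A : Type*} [AddCommGroup A] (H : AddSubgroup A) (s : ℝ) (f : A → ℝ≥0∞) :
    HBLnorm s (fun q : A ⧸ H => HBLnorm s fun y : H => f (q.out + y)) = HBLnorm s f := by
  rw [← HBLnorm_comp_equiv (QuotientAddGroup.outAddEquiv H) s f]
  exact HBLnorm_prod s fun p => f (QuotientAddGroup.outAddEquiv H p)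

section

variable {G : Type*} [AddCommGroup G] {m : ℕ} {Gj : Fin m → Type*} [∀ j, AddCommGroup (Gj j)]

theorem one_le_HBLB (φ : ∀ j, G →+ Gj j) {s : Fin m → ℝ} (hs : ∀ j, 0 ≤ s j) :
    1 ≤ HBLB φ s := by
  classical
  refine le_sInf fun C hC => ?_
  have h := hC fun j => Pi.single 0 1
  simp only [HBLnorm_single_one _ (hs _), Finset.prod_const_one, mul_one] at h
  refine le_trans ?_ h
  refine le_trans ?_ (ENNReal.le_tsum 0)
  simp

theorem tsum_prod_le_HBLB_mul (φ : ∀ j, G →+ Gj j) {s : Fin m → ℝ} (hs : ∀ j, 0 ≤ s j)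
    (f : ∀ j, Gj j → ℝ≥0∞) :
    ∑' x : G, ∏ j, f j (φ j x) ≤ HBLB φ s * ∏ j, HBLnorm (s j) (f j) := by
  by_cases h0 : ∏ j, HBLnorm (s j) (f j) = 0
  · obtain ⟨j, -, hj⟩ := Finset.prod_eq_zero_iff.mp h0
    have : ∀ x : G, ∏ j, f j (φ j x) = 0 := fun x =>
      Finset.prod_eq_zero (Finset.mem_univ j) (eq_zero_of_HBLnorm_eq_zero (hs j) hj _)
    simp [this]
  by_cases htop : ∏ j, HBLnorm (s j) (f j) = ⊤
  · rw [htop, ENNReal.mul_top (zero_lt_one.trans_le (one_le_HBLB φ hs)).ne']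
    exact le_top
  rw [← ENNReal.div_le_iff h0 htop]
  exact le_sInf fun C hC => (ENNReal.div_le_iff h0 htop).mpr (hC f)

end

/-- **Lemma (factorization for `𝔹`).** For any Abelian group HBL datum `𝒢` (no
finiteness assumed), any `s ∈ [0,1]^m`, and any subgroup `G' ≤ G`, with the sub-datum
`𝒢' = (φ_j|_{G'} : G' → φ_j(G'))` and quotient datum `𝒢/𝒢' = (ψ_j : G/G' → G_j/φ_j(G'))`,
one has `𝔹(𝒢,s) ≤ 𝔹(𝒢/𝒢',s) · 𝔹(𝒢',s)`. -/
theorem HBLB_factorization {G : Type*} [AddCommGroup G]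
    {m : ℕ} (hm : 0 < m) {Gj : Fin m → Type*} [∀ j, AddCommGroup (Gj j)]
    (φ : ∀ j, G →+ Gj j) (s : Fin m → ℝ) (hs : ∀ j, s j ∈ Set.Icc (0 : ℝ) 1)
    (G' : AddSubgroup G) :
    HBLB φ s ≤
      HBLB (fun j => QuotientAddGroup.map G' (G'.map (φ j)) (φ j)
          (fun _ hx => AddSubgroup.mem_map_of_mem (φ j) hx)) s *
        HBLB (fun j => (φ j).addSubgroupMap G') s := by
  have hs0 : ∀ j, 0 ≤ s j := fun j => (hs j).1
  refine sInf_le fun f => ?_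
  let F : ∀ j, Gj j ⧸ G'.map (φ j) → ℝ≥0∞ := fun j c =>
    HBLnorm (s j) fun y : G'.map (φ j) => f j (c.out + y)
  set ψ : ∀ j, G ⧸ G' →+ Gj j ⧸ G'.map (φ j) := fun j =>
    QuotientAddGroup.map G' (G'.map (φ j)) (φ j)
      fun _ hx => AddSubgroup.mem_map_of_mem (φ j) hx
  have hfib : ∀ q : G ⧸ G', ∑' h : G', ∏ j, f j (φ j (q.out + h)) ≤
      HBLB (fun j => (φ j).addSubgroupMap G') s * ∏ j, F j (ψ j q) := by
    intro q
    have h := tsum_prod_le_HBLB_mul (fun j => (φ j).addSubgroupMap G') hs0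
      fun j y => f j (φ j q.out + y)
    have hF : ∀ j, HBLnorm (s j) (fun y : G'.map (φ j) => f j (φ j q.out + y)) = F j (ψ j q) := by
      intro j
      refine HBLnorm_translate_eq (s j) (f j) ?_
      conv_rhs => rw [QuotientAddGroup.out_eq', ← QuotientAddGroup.out_eq' q]
      rfl
    simp only [hF] at h
    simpa only [map_add, AddMonoidHom.addSubgroupMap_apply_coe] using h
  calc ∑' x : G, ∏ j, f j (φ j x)
      = ∑' (q : G ⧸ G') (h : G'), ∏ j, f j (φ j (q.out + h)) := by
        rw [← (QuotientAddGroup.outAddEquiv G').tsum_eq, ENNReal.tsum_prod']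
        rfl
    _ ≤ ∑' q : G ⧸ G', HBLB (fun j => (φ j).addSubgroupMap G') s * ∏ j, F j (ψ j q) :=
        ENNReal.tsum_le_tsum hfib
    _ = HBLB (fun j => (φ j).addSubgroupMap G') s * ∑' q : G ⧸ G', ∏ j, F j (ψ j q) :=
        ENNReal.tsum_mul_left
    _ ≤ HBLB (fun j => (φ j).addSubgroupMap G') s *
          (HBLB ψ s * ∏ j, HBLnorm (s j) (F j)) := by
        gcongr
        exact tsum_prod_le_HBLB_mul ψ hs0 F
    _ = HBLB ψ s * HBLB (fun j => (φ j).addSubgroupMap G') s * ∏ j, HBLnorm (s j) (f j) := by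
        simp only [F, HBLnorm_coset]
        ring
end

section
/- Let 𝒢 = (φ_j : G → G_j : 1 ≤ j ≤ m) be a finite Abelian group HBL datum (i.e., G and all G_j are finite) and let s ∈ [0,1]^m. If s_j ∈ {0,1} for all but at most one index j, then 𝔸(𝒢,s) = 𝔹(𝒢,s). -/
open scoped ENNReal

/-- Summing over a subgroup through a homomorphism: each value is hit equally often. -/
theorem card_map_mul_sum_le {G G' : Type*} [AddCommGroup G] [Fintype G] [AddCommGroup G']
    [Fintype G'] (φ : G →+ G') (K : AddSubgroup G) [Fintype K] (g : G' → ℝ≥0∞) (a : G') :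
    (Nat.card (K.map φ) : ℝ≥0∞) * ∑ k : K, g (a + φ k) ≤ Nat.card K * ∑ y, g y := by
  classical
  have : Fintype (K.map φ) := Fintype.ofFinite _
  have shift : ∀ y : K.map φ, ∑ k : K, g (a + φ k) = ∑ k : K, g (a + φ k + y) := by
    rintro ⟨_, k', hk', rfl⟩
    rw [← Equiv.sum_comp (Equiv.addRight (⟨k', hk'⟩ : K))]
    simp [add_assoc]
  calc (Nat.card (K.map φ) : ℝ≥0∞) * ∑ k : K, g (a + φ k)
      = ∑ y : K.map φ, ∑ k : K, g (a + φ k) := by simp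
    _ = ∑ y : K.map φ, ∑ k : K, g (a + φ k + y) := Finset.sum_congr rfl fun y _ => shift y
    _ = ∑ k : K, ∑ y : K.map φ, g (a + φ k + y) := Finset.sum_comm
    _ ≤ ∑ _k : K, ∑ y, g y := by
        refine Finset.sum_le_sum fun k _ => ?_
        rw [← Equiv.sum_comp (Equiv.addLeft (a + φ k)) g, ← tsum_fintype (L := .unconditional _),
          ← tsum_fintype (L := .unconditional _)]
        exact ENNReal.tsum_comp_le_tsum_of_injective Subtype.val_injective
          (fun y => g (Equiv.addLeft (a + φ k) y))
    _ = Nat.card K * ∑ y, g y := by simp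

/-- The one-function HBL inequality on a coset of a subgroup. -/
theorem sum_subgroup_le_HBLnorm {G G' : Type*} [AddCommGroup G] [Fintype G] [AddCommGroup G']
    [Fintype G'] (φ : G →+ G') (K : AddSubgroup G) [Fintype K] (f : G' → ℝ≥0∞) (a : G')
    {t : ℝ} (ht : t ∈ Set.Icc (0 : ℝ) 1) :
    ∑ k : K, f (a + φ k) ≤
      Nat.card K * (Nat.card (K.map φ) : ℝ≥0∞) ^ (-t) * HBLnorm t f := by
  obtain ⟨h0, h1⟩ := ht
  rcases h0.eq_or_lt with rfl | h0
  · calc ∑ k : K, f (a + φ k) ≤ ∑ _k : K, ⨆ y, f y :=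
          Finset.sum_le_sum fun k _ => le_iSup f (a + φ k)
      _ = _ := by simp [HBLnorm]
  · have hc0 : (Nat.card (K.map φ) : ℝ≥0∞) ≠ 0 := by
      exact_mod_cast Nat.card_pos.ne'
    have hct : (Nat.card (K.map φ) : ℝ≥0∞) ≠ ⊤ := ENNReal.natCast_ne_top _
    have hk0 : (Nat.card K : ℝ≥0∞) ≠ 0 := by
      exact_mod_cast Nat.card_pos.ne'
    have hkt : (Nat.card K : ℝ≥0∞) ≠ ⊤ := ENNReal.natCast_ne_top _
    have hp : 1 ≤ 1 / t := (one_le_div h0).2 h1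
    have jensen := ENNReal.rpow_sum_le_const_mul_sum_rpow (Finset.univ : Finset K)
      (fun k => f (a + φ k)) hp
    have fiber := card_map_mul_sum_le φ K (fun y => f y ^ (1 / t)) a
    have fiber' : ∑ k : K, f (a + φ k) ^ (1 / t) ≤
        (Nat.card (K.map φ) : ℝ≥0∞)⁻¹ * (Nat.card K * ∑ y, f y ^ (1 / t)) := by
      rw [← ENNReal.mul_le_iff_le_inv hc0 hct]
      exact fiber
    have key : (∑ k : K, f (a + φ k)) ^ (1 / t) ≤
        (Nat.card K : ℝ≥0∞) ^ (1 / t) *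
          ((Nat.card (K.map φ) : ℝ≥0∞)⁻¹ * ∑ y, f y ^ (1 / t)) := by
      refine jensen.trans ((mul_le_mul_right fiber' _).trans_eq ?_)
      rw [ENNReal.rpow_sub _ _ (by simp) (by simp), ENNReal.rpow_one, Finset.card_univ,
        ← Nat.card_eq_fintype_card, div_eq_mul_inv]
      calc _ = (Nat.card K : ℝ≥0∞) ^ (1 / t) * ((Nat.card K : ℝ≥0∞)⁻¹ * Nat.card K) *
            ((Nat.card (K.map φ) : ℝ≥0∞)⁻¹ * ∑ y, f y ^ (1 / t)) := by ring
        _ = _ := by rw [ENNReal.inv_mul_cancel hk0 hkt, mul_one]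
    have := ENNReal.rpow_le_rpow key h0.le
    rw [← ENNReal.rpow_mul, one_div_mul_cancel h0.ne', ENNReal.rpow_one,
      ENNReal.mul_rpow_of_nonneg _ _ h0.le, ENNReal.mul_rpow_of_nonneg _ _ h0.le,
      ← ENNReal.rpow_mul, one_div_mul_cancel h0.ne', ENNReal.rpow_one, ENNReal.inv_rpow,
      ← ENNReal.rpow_neg, ← mul_assoc] at this
    simpa [HBLnorm, h0.ne'] using this

/-- The norm of the indicator of a finite nonempty set. -/
theorem HBLnorm_indicator {α : Type*} [Fintype α] (A : Set α) (hA : A.Nonempty) {t : ℝ}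
    (ht : 0 ≤ t) : HBLnorm t (A.indicator 1) = (Nat.card A : ℝ≥0∞) ^ t := by
  classical
  rcases ht.eq_or_lt with rfl | h0
  · obtain ⟨y, hy⟩ := hA
    simp only [HBLnorm, if_true, ENNReal.rpow_zero]
    refine le_antisymm (iSup_le fun z => ?_) (le_iSup_of_le y (by simp [hy]))
    exact Set.indicator_le_self' (by simp) z
  · have : ∀ y, (A.indicator (1 : α → ℝ≥0∞) y) ^ (1 / t) = if y ∈ A then 1 else 0 := by
      intro y
      by_cases hy : y ∈ A <;> simp [hy, h0]
    simp only [HBLnorm, h0.ne', if_false, this, tsum_fintype, Finset.sum_boole]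
    rw [Nat.card_eq_fintype_card, Fintype.card_subtype]

/-- Testing on indicators of subgroups: `𝔸 ≤ 𝔹`. -/
theorem HBLA_le_HBLB {G : Type*} [AddCommGroup G] [Fintype G]
    {m : ℕ} {Gj : Fin m → Type*} [∀ j, AddCommGroup (Gj j)]
    [∀ j, Fintype (Gj j)] (φ : ∀ j, G →+ Gj j)
    (s : Fin m → ℝ) (hs : ∀ j, 0 ≤ s j) : HBLA φ s ≤ HBLB φ s := by
  classical
  refine iSup₂_le fun H _ => le_sInf fun C hC => ?_
  have hf := hC fun j => ((H.map (φ j) : Set (Gj j))).indicator 1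
  have hnorm : ∀ j, HBLnorm (s j) ((H.map (φ j) : Set (Gj j)).indicator 1) =
      (Nat.card (H.map (φ j)) : ℝ≥0∞) ^ s j := fun j =>
    HBLnorm_indicator _ ⟨0, zero_mem _⟩ (hs j)
  simp only [hnorm] at hf
  have hH : (Nat.card H : ℝ≥0∞) ≤
      ∑' x : G, ∏ j, ((H.map (φ j) : Set (Gj j))).indicator (1 : Gj j → ℝ≥0∞) (φ j x) := by
    have : (Nat.card H : ℝ≥0∞) = ∑ x : G, if x ∈ H then 1 else 0 := by
      rw [Finset.sum_boole, Nat.card_eq_fintype_card, Fintype.card_subtype]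
    rw [this, tsum_fintype]
    refine Finset.sum_le_sum fun x _ => ?_
    split_ifs with hx
    · refine le_of_eq (Finset.prod_eq_one fun j _ => ?_).symm
      exact Set.indicator_of_mem (AddSubgroup.mem_map_of_mem _ hx) _
    · exact zero_le
  calc HBLAloc φ s H
      ≤ (C * ∏ j, (Nat.card (H.map (φ j)) : ℝ≥0∞) ^ s j) *
          ∏ j, (Nat.card (H.map (φ j)) : ℝ≥0∞) ^ (-(s j)) :=
        mul_le_mul_left (hH.trans hf) _
    _ = C := by
        rw [mul_assoc, ← Finset.prod_mul_distrib, Finset.prod_eq_one, mul_one]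
        intro j _
        have hc0 : (Nat.card (H.map (φ j)) : ℝ≥0∞) ≠ 0 := by
          exact_mod_cast Nat.card_pos.ne'
        rw [← ENNReal.rpow_add _ _ hc0 (ENNReal.natCast_ne_top _), add_neg_cancel,
          ENNReal.rpow_zero]

/-- The reverse inequality, with the extremal subgroup the common kernel of the `φ j`, `s j = 1`. -/
theorem HBLB_le_HBLA {G : Type*} [AddCommGroup G] [Fintype G]
    {m : ℕ} {Gj : Fin m → Type*} [∀ j, AddCommGroup (Gj j)]
    [∀ j, Fintype (Gj j)] (φ : ∀ j, G →+ Gj j) (s : Fin m → ℝ) (i : Fin m)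
    (hi : s i ∈ Set.Icc (0 : ℝ) 1) (h01 : ∀ j, j ≠ i → s j = 0 ∨ s j = 1) :
    HBLB φ s ≤ HBLA φ s := by
  classical
  let S : Finset (Fin m) := (Finset.univ.erase i).filter fun j => s j = 1
  let T : Finset (Fin m) := (Finset.univ.erase i).filter fun j => ¬ s j = 1
  have split : ∀ u : Fin m → ℝ≥0∞, ∏ j, u j = u i * ((∏ j : S, u j) * ∏ j ∈ T, u j) := by
    intro u
    rw [Finset.prod_coe_sort S u, Finset.prod_filter_mul_prod_filter_not,
      Finset.mul_prod_erase _ _ (Finset.mem_univ i)]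
  let Ψ : G →+ (∀ j : S, Gj j) := AddMonoidHom.mk' (fun x j => φ j x) fun x y => by
    ext j; simp
  let K : AddSubgroup G := Ψ.ker
  have hA : HBLAloc φ s K = Nat.card K * (Nat.card (K.map (φ i)) : ℝ≥0∞) ^ (-(s i)) := by
    unfold HBLAloc
    rw [Fintype.prod_eq_single i]
    intro j hj
    rcases h01 j hj with h | h
    · simp [h]
    · have : K.map (φ j) = ⊥ := by
        rw [eq_bot_iff, AddSubgroup.map_le_iff_le_comap]
        intro x hx
        exact congrFun (show Ψ x = 0 from hx) ⟨j, by simp [S, hj, h]⟩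
      simp [this]
  refine sInf_le_of_le (fun f => ?_)
    (le_iSup₂_of_le K (Set.toFinite _) le_rfl : HBLAloc φ s K ≤ _)
  have fiber : ∀ p : (∀ j : S, Gj j),
      ∑ x with Ψ x = p, f i (φ i x) ≤ HBLAloc φ s K * HBLnorm (s i) (f i) := by
    intro p
    by_cases hp : ∃ x₀, Ψ x₀ = p
    · obtain ⟨x₀, rfl⟩ := hp
      rw [hA]
      refine le_trans (le_of_eq ?_) (sum_subgroup_le_HBLnorm (φ i) K (f i) (φ i x₀) hi)
      refine Finset.sum_bij' (fun x hx => (⟨x - x₀, ?_⟩ : K)) (fun k _ => x₀ + k) ?_ ?_ ?_ ?_ ?_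
      · have : Ψ x = Ψ x₀ := by simpa using hx
        simp [K, AddMonoidHom.mem_ker, this]
      · simp
      · rintro ⟨k, hk⟩ _
        have : Ψ k = 0 := hk
        simp [this]
      · simp
      · simp
      · simp
    · rw [Finset.sum_eq_zero]
      · exact zero_le
      · intro x hx
        exact absurd ⟨x, by simpa using hx⟩ hp
  have hS : ∏ j : S, HBLnorm (s j) (f j) = ∏ j : S, ∑ y, f j y := by
    refine Finset.prod_congr rfl fun j _ => ?_
    have : s j = 1 := (Finset.mem_filter.1 j.2).2
    simp [HBLnorm, this]
  have hT : ∀ x, ∏ j ∈ T, f j (φ j x) ≤ ∏ j ∈ T, HBLnorm (s j) (f j) := by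
    refine fun x => Finset.prod_le_prod' fun j hj => ?_
    obtain ⟨hj, hj1⟩ := Finset.mem_filter.1 hj
    have : s j = 0 := (h01 j (Finset.ne_of_mem_erase hj)).resolve_right hj1
    simpa [HBLnorm, this] using le_iSup (f j) (φ j x)
  calc ∑' x, ∏ j, f j (φ j x)
      = ∑ x, f i (φ i x) * ((∏ j : S, f j (Ψ x j)) * ∏ j ∈ T, f j (φ j x)) := by
        rw [tsum_fintype]
        exact Finset.sum_congr rfl fun x _ => split fun j => f j (φ j x)
    _ ≤ ∑ x, f i (φ i x) * ((∏ j : S, f j (Ψ x j)) * ∏ j ∈ T, HBLnorm (s j) (f j)) :=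
        Finset.sum_le_sum fun x _ => mul_le_mul_right (mul_le_mul_right (hT x) _) _
    _ = (∑ x, f i (φ i x) * ∏ j : S, f j (Ψ x j)) * ∏ j ∈ T, HBLnorm (s j) (f j) := by
        simp only [Finset.sum_mul, mul_assoc]
    _ = (∑ p, (∑ x with Ψ x = p, f i (φ i x)) * ∏ j : S, f j (p j)) *
          ∏ j ∈ T, HBLnorm (s j) (f j) := by
        rw [← Finset.sum_fiberwise Finset.univ Ψ]
        congr 1
        refine Finset.sum_congr rfl fun p _ => ?_
        rw [Finset.sum_mul]
        refine Finset.sum_congr rfl fun x hx => ?_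
        rw [(Finset.mem_filter.1 hx).2]
    _ ≤ (∑ p : (∀ j : S, Gj j), (HBLAloc φ s K * HBLnorm (s i) (f i)) * ∏ j : S, f j (p j)) *
          ∏ j ∈ T, HBLnorm (s j) (f j) := by
        gcongr with p
        exact fiber p
    _ = HBLAloc φ s K * ∏ j, HBLnorm (s j) (f j) := by
        rw [split fun j => HBLnorm (s j) (f j), hS, Finset.prod_univ_sum, Fintype.piFinset_univ,
          ← Finset.mul_sum]
        simp only [mul_assoc]

/-- **Lemma.** For a finite Abelian group HBL datum `𝒢` and `s ∈ [0,1]^m`, if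
`s_j ∈ {0,1}` for all but at most one index `j`, then `𝔸(𝒢,s) = 𝔹(𝒢,s)`. -/
theorem HBL_fundamental_case {G : Type*} [AddCommGroup G] [Fintype G]
    {m : ℕ} (hm : 0 < m) {Gj : Fin m → Type*} [∀ j, AddCommGroup (Gj j)]
    [∀ j, Fintype (Gj j)] (φ : ∀ j, G →+ Gj j)
    (s : Fin m → ℝ) (hs : ∀ j, s j ∈ Set.Icc (0 : ℝ) 1)
    (h01 : ∃ i, ∀ j, j ≠ i → s j = 0 ∨ s j = 1) :
    HBLA φ s = HBLB φ s := by
  obtain ⟨i, hi⟩ := h01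
  exact le_antisymm (HBLA_le_HBLB φ s fun j => (hs j).1) (HBLB_le_HBLA φ s i (hs i) hi)
end
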